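/- Every seminorm p on a *-algebra A satisfying the C*-condition p(a*a) = p(a)^2 for all a ∈ A is submultiplicative, i.e., p(ab) ≤ p(a)p(b) for all a, b ∈ A. -/

import Mathlib

namespace CStarSeminorm

section Bounded

variable {A : Type*} [Ring A] [Algebra ℂ A] {p : Seminorm ℂ A}

theorem map_nsmul_eq (n : ℕ) (x : A) : p (n • x) = n * p x := by
  rw [← Nat.cast_smul_eq_nsmul ℂ, map_smul_eq_mul]
  simp

theorem map_add_self (x : A) : p (x + x) = 2 * p x := by
  rw [← two_nsmul]
  exact_mod_cast map_nsmul_eq 2 x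

variable [StarRing A]

theorem polarization_aux (hC : ∀ a : A, p (star a * a) = p a ^ 2) (x y : A) :
    p (star x * y + star y * x) ≤ (p x + p y) ^ 2 := by
  have h1 : (star x * y + star y * x) + (star x * y + star y * x)
      = star (x + y) * (x + y) - star (x - y) * (x - y) := by
    simp only [star_add, star_sub]; noncomm_ring
  have h2 := map_sub_le_add p (star (x + y) * (x + y)) (star (x - y) * (x - y))
  rw [← h1, map_add_self, hC, hC] at h2
  have h3 := map_add_le_add p x y
  have h4 := map_sub_le_add p x y
  have h5 := pow_le_pow_left₀ (apply_nonneg p _) h3 2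
  have h6 := pow_le_pow_left₀ (apply_nonneg p _) h4 2
  linarith

theorem polarization_of_pos (hC : ∀ a : A, p (star a * a) = p a ^ 2) (x y : A) {a b : ℝ}
    (ha : 0 < a) (hb : 0 < b) (hxa : p x ≤ a) (hyb : p y ≤ b) :
    p (star x * y + star y * x) ≤ 9 * (a * b) := by
  set K := (a + b) / (a * b)
  have hab : 0 < a * b := mul_pos ha hb
  have hK : K * (a * b) = a + b := div_mul_cancel₀ _ hab.ne'
  have hK0 : 0 < K := by positivity
  set m := ⌈K * b⌉₊
  set n := ⌈K * a⌉₊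
  have hm1 : K * b ≤ m := Nat.le_ceil _
  have hn1 : K * a ≤ n := Nat.le_ceil _
  have hm2 : (m : ℝ) ≤ K * b + 1 := (Nat.ceil_lt_add_one (by positivity)).le
  have hn2 : (n : ℝ) ≤ K * a + 1 := (Nat.ceil_lt_add_one (by positivity)).le
  have h := polarization_aux hC (m • x) (n • y)
  have e : star (m • x) * (n • y) + star (n • y) * (m • x)
      = (m * n) • (star x * y + star y * x) := by
    simp only [star_nsmul, smul_mul_assoc, mul_smul_comm, smul_add, smul_smul, mul_comm n m]
  rw [e, map_nsmul_eq, map_nsmul_eq, map_nsmul_eq, Nat.cast_mul] at h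
  set P := p (star x * y + star y * x)
  have hP : 0 ≤ P := apply_nonneg p _
  have s1 : (m : ℝ) * p x + n * p y ≤ 3 * (a + b) := by
    have := mul_le_mul hm2 hxa (apply_nonneg p _) (by positivity)
    have := mul_le_mul hn2 hyb (apply_nonneg p _) (by positivity)
    nlinarith
  have s2 : ((m : ℝ) * p x + n * p y) ^ 2 ≤ (3 * (a + b)) ^ 2 :=
    pow_le_pow_left₀ (by positivity) s1 2
  have s3 : K * b * (K * a) * P ≤ m * n * P := by gcongr
  have s4 : K * b * (K * a) = K * (a + b) := by rw [← hK]; ring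
  have s5 : K * (a + b) * P ≤ K * (a + b) * (9 * (a * b)) := by
    calc K * (a + b) * P ≤ (3 * (a + b)) ^ 2 := by rw [← s4]; linarith
      _ = 9 * ((a + b) * (K * (a * b))) := by rw [hK]; ring
      _ = _ := by ring
  exact le_of_mul_le_mul_left s5 (by positivity)

theorem polarization (hC : ∀ a : A, p (star a * a) = p a ^ 2) (x y : A) :
    p (star x * y + star y * x) ≤ 9 * (p x * p y) := by
  have hlim : Filter.Tendsto (fun ε : ℝ => 9 * ((p x + ε) * (p y + ε)))
      (nhdsWithin 0 (Set.Ioi 0)) (nhds (9 * ((p x + 0) * (p y + 0)))) :=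
    (Continuous.tendsto (by fun_prop) 0).mono_left nhdsWithin_le_nhds
  rw [add_zero, add_zero] at hlim
  refine ge_of_tendsto hlim ?_
  filter_upwards [self_mem_nhdsWithin] with ε (hε : 0 < ε)
  have hx := apply_nonneg p x
  have hy := apply_nonneg p y
  exact polarization_of_pos hC x y (by positivity) (by positivity) (by linarith) (by linarith)

theorem map_one_le (hC : ∀ a : A, p (star a * a) = p a ^ 2) : p (1 : A) ≤ 1 := by
  have h := hC 1
  rw [star_one, mul_one] at h
  nlinarith [apply_nonneg p (1 : A)]

theorem map_star_le (hC : ∀ a : A, p (star a * a) = p a ^ 2) (x : A) :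
    p (star x) ≤ 10 * p x := by
  have h := polarization hC x 1
  rw [mul_one, star_one, one_mul] at h
  have h2 := map_sub_le_add p (star x + x) x
  rw [add_sub_cancel_right] at h2
  nlinarith [map_one_le hC, apply_nonneg p x]

theorem map_mul_add_star_le (hC : ∀ a : A, p (star a * a) = p a ^ 2) (x y : A) :
    p (x * y + star y * star x) ≤ 90 * (p x * p y) := by
  have h := polarization hC (star x) y
  rw [star_star] at h
  nlinarith [mul_le_mul_of_nonneg_right (map_star_le hC x) (apply_nonneg p y)]

theorem map_sq_of_isSelfAdjoint (hC : ∀ a : A, p (star a * a) = p a ^ 2) {h : A}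
    (hh : star h = h) : p (h * h) = p h ^ 2 := by
  simpa [hh] using hC h

theorem map_sq_of_skew (hC : ∀ a : A, p (star a * a) = p a ^ 2) {u : A}
    (hu : star u = -u) : p (u * u) = p u ^ 2 := by
  simpa [hu] using hC u

theorem map_jordan_le (hC : ∀ a : A, p (star a * a) = p a ^ 2) {h k : A}
    (hh : star h = h) (hk : star k = k) : p (h * k + k * h) ≤ 90 * (p h * p k) := by
  simpa [hh, hk] using map_mul_add_star_le hC h k

theorem map_quadratic_le (hC : ∀ a : A, p (star a * a) = p a ^ 2) {h k : A}
    (hh : star h = h) (hk : star k = k) : p (h * k * h) ≤ 4095 * (p h ^ 2 * p k) := by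
  have e : h * k * h + h * k * h
      = ((h * k + k * h) * h + h * (h * k + k * h)) - (h * h * k + k * (h * h)) := by
    noncomm_ring
  have h1 := map_sub_le_add p ((h * k + k * h) * h + h * (h * k + k * h))
    (h * h * k + k * (h * h))
  rw [← e, map_add_self] at h1
  have hs : star (h * k + k * h) = h * k + k * h := by
    simp [hh, hk, add_comm]
  have h2 := map_jordan_le hC hs hh
  have h3 := map_jordan_le hC (h := h * h) (k := k) (by simp [hh]) hk
  rw [map_sq_of_isSelfAdjoint hC hh] at h3
  have h4 := mul_le_mul_of_nonneg_right (map_jordan_le hC hh hk) (apply_nonneg p h)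
  nlinarith

theorem le_mul_of_sq_le {a b t α β : ℝ} (hα : 0 ≤ α) (hβ : 0 ≤ β) (hb : 0 ≤ b)
    (h : t ^ 2 ≤ α * (t * b) + β * b ^ 2) (ha : a = α + β + 1) : t ≤ a * b := by
  subst ha
  by_contra! hlt
  have hbt : b < t ∨ b = 0 := by
    rcases hb.eq_or_lt with hb | hb
    · exact Or.inr hb.symm
    · left; nlinarith [mul_nonneg (add_nonneg hα hβ) hb.le]
  rcases hbt with hbt | rfl
  · have ht : 0 < t := hb.trans_lt hbt
    have h1 := mul_lt_mul_of_pos_right hlt ht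
    have h2 : β * b ^ 2 ≤ β * (b * t) := by
      rw [sq]; gcongr
    nlinarith [mul_nonneg hb ht.le]
  · simp only [mul_zero] at hlt h
    nlinarith

theorem exists_map_mul_le_of_selfAdjoint_of_selfAdjoint
    (hC : ∀ a : A, p (star a * a) = p a ^ 2) :
    ∃ C : ℝ, 0 ≤ C ∧ ∀ h k : A, star h = h → star k = k → p (h * k) ≤ C * (p h * p k) := by
  refine ⟨(376740 + 1 + 90) / 2, by norm_num, fun h k hh hk => ?_⟩
  have hP := mul_nonneg (apply_nonneg p h) (apply_nonneg p k)
  have hd : star (h * k - k * h) = -(h * k - k * h) := by simp [hh, hk]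
  have e : (h * k - k * h) * (h * k - k * h)
      = (h * (k * h * k) + k * h * k * h) - h * (k * k) * h - k * (h * h) * k := by
    noncomm_ring
  have h1 := map_sub_le_add p ((h * (k * h * k) + k * h * k * h) - h * (k * k) * h)
    (k * (h * h) * k)
  have h2 := map_sub_le_add p (h * (k * h * k) + k * h * k * h) (h * (k * k) * h)
  rw [← e, map_sq_of_skew hC hd] at h1
  have h3 := map_jordan_le hC (h := h) (k := k * h * k) hh (by simp [hh, hk, mul_assoc])
  have h4 := mul_le_mul_of_nonneg_left (map_quadratic_le hC hk hh) (apply_nonneg p h)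
  have h5 := map_quadratic_le hC (h := h) (k := k * k) hh (by simp [hk])
  have h6 := map_quadratic_le hC (h := k) (k := h * h) hk (by simp [hh])
  rw [map_sq_of_isSelfAdjoint hC hk] at h5
  rw [map_sq_of_isSelfAdjoint hC hh] at h6
  have h7 : p (h * k - k * h) ≤ (376740 + 1) * (p h * p k) := by
    refine le_mul_of_sq_le (α := 0) (β := 376740) le_rfl (by norm_num) hP ?_ (by norm_num)
    nlinarith
  have h8 := map_add_le_add p (h * k - k * h) (h * k + k * h)
  rw [show (h * k - k * h) + (h * k + k * h) = h * k + h * k by abel, map_add_self] at h8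
  linarith [map_jordan_le hC hh hk]

theorem exists_map_mul_le_of_selfAdjoint_of_skew
    (hC : ∀ a : A, p (star a * a) = p a ^ 2) :
    ∃ C : ℝ, 0 ≤ C ∧ ∀ h u : A, star h = h → star u = -u → p (h * u) ≤ C * (p h * p u) := by
  refine ⟨(3000 + 300000 + 1 + 90) / 2, by norm_num, fun h u hh hu => ?_⟩
  have hP := mul_nonneg (apply_nonneg p h) (apply_nonneg p u)
  have hcomm := map_mul_add_star_le hC h u
  rw [hh, hu, neg_mul, ← sub_eq_add_neg] at hcomm
  set E := p (h * u + u * h) with hE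
  have hE0 : 0 ≤ E := apply_nonneg p _
  have hhu : 2 * p (h * u) ≤ E + 90 * (p h * p u) := by
    have := map_add_le_add p (h * u + u * h) (h * u - u * h)
    rw [show (h * u + u * h) + (h * u - u * h) = h * u + h * u by abel, map_add_self] at this
    linarith
  have huhu : p (u * h * u) ≤ 45 * (p u * p (h * u)) := by
    have := map_mul_add_star_le hC u (h * u)
    rw [star_mul, hh, hu, show u * (h * u) + -u * h * -u = u * h * u + u * h * u by noncomm_ring,
      map_add_self] at this
    linarith
  have hskew : star (h * u + u * h) = -(h * u + u * h) := by simp [hh, hu]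
  have e : (h * u + u * h) * (h * u + u * h)
      = (h * (u * h * u) + u * h * u * h) + h * (u * u) * h - star (h * u) * (h * u) := by
    rw [star_mul, hh, hu]; noncomm_ring
  have h1 := map_sub_le_add p ((h * (u * h * u) + u * h * u * h) + h * (u * u) * h)
    (star (h * u) * (h * u))
  have h2 := map_add_le_add p (h * (u * h * u) + u * h * u * h) (h * (u * u) * h)
  rw [← e, map_sq_of_skew hC hskew, hC] at h1
  have h3 := map_jordan_le hC (h := h) (k := u * h * u) hh (by simp [hh, hu, mul_assoc])
  have h4 := mul_le_mul_of_nonneg_left huhu (apply_nonneg p h)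
  have h5 := map_quadratic_le hC (h := h) (k := u * u) hh (by simp [hu])
  rw [map_sq_of_skew hC hu] at h5
  have h6 := mul_le_mul_of_nonneg_left hhu hP
  have h7 := pow_le_pow_left₀ (by positivity) hhu 2
  have h8 : E ≤ (3000 + 300000 + 1) * (p h * p u) := by
    refine le_mul_of_sq_le (α := 3000) (β := 300000) (by norm_num) (by norm_num) hP ?_ rfl
    nlinarith [mul_nonneg hE0 hP, sq_nonneg (p h * p u)]
  linarith

theorem exists_map_mul_le_of_selfAdjoint (hC : ∀ a : A, p (star a * a) = p a ^ 2) :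
    ∃ C : ℝ, 0 ≤ C ∧ ∀ h y : A, star h = h → p (h * y) ≤ C * (p h * p y) := by
  obtain ⟨C₁, hC₁, H₁⟩ := exists_map_mul_le_of_selfAdjoint_of_selfAdjoint hC
  obtain ⟨C₂, hC₂, H₂⟩ := exists_map_mul_le_of_selfAdjoint_of_skew hC
  refine ⟨C₁ * 11 + C₂ * 11, by positivity, fun h y hh => ?_⟩
  have h1 := H₁ h (y + star y) hh (by simp [add_comm])
  have h2 := H₂ h (y - star y) hh (by simp)
  have h3 := map_add_le_add p (h * (y + star y)) (h * (y - star y))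
  rw [show h * (y + star y) + h * (y - star y) = h * y + h * y by noncomm_ring,
    map_add_self] at h3
  have h4 : p (y + star y) ≤ 11 * p y := by linarith [map_add_le_add p y (star y), map_star_le hC y]
  have h5 : p (y - star y) ≤ 11 * p y := by linarith [map_sub_le_add p y (star y), map_star_le hC y]
  have hh0 := apply_nonneg p h
  have hy0 := apply_nonneg p y
  have h6 : C₁ * (p h * p (y + star y)) ≤ C₁ * (p h * (11 * p y)) := by gcongr
  have h7 : C₂ * (p h * p (y - star y)) ≤ C₂ * (p h * (11 * p y)) := by gcongr
  nlinarith [mul_nonneg (mul_nonneg (add_nonneg hC₁ hC₂) hh0) hy0]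

theorem exists_map_mul_le (hC : ∀ a : A, p (star a * a) = p a ^ 2) :
    ∃ C : ℝ, 0 < C ∧ ∀ x y : A, p (x * y) ≤ C * (p x * p y) := by
  obtain ⟨C, hC0, H⟩ := exists_map_mul_le_of_selfAdjoint hC
  refine ⟨450 * C + 1, by positivity, fun x y => ?_⟩
  have h1 := map_mul_add_star_le hC (star y) (star x * x * y)
  have e : star y * (star x * x * y) + star (star x * x * y) * star (star y)
      = star (x * y) * (x * y) + star (x * y) * (x * y) := by
    simp [mul_assoc]
  rw [e, map_add_self, hC] at h1
  have h2 := H (star x * x) y (by simp)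
  rw [hC] at h2
  have hx := apply_nonneg p x
  have hy := apply_nonneg p y
  have h3 : p (star y) * p (star x * x * y) ≤ 10 * p y * (C * (p x ^ 2 * p y)) :=
    mul_le_mul (map_star_le hC y) h2 (apply_nonneg p _) (by positivity)
  refine le_mul_of_sq_le (α := 0) (β := 450 * C) le_rfl (by positivity) (by positivity) ?_
    (by ring)
  nlinarith

end Bounded

section Limits

theorem tendsto_rpow_one_div_two_pow {C : ℝ} (hC : 0 < C) (a : ℝ) :
    Filter.Tendsto (fun n : ℕ => C ^ (1 / ((2 ^ n : ℕ) : ℝ)) * a) Filter.atTop (nhds a) := by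
  have h1 : Filter.Tendsto (fun n : ℕ => 1 / ((2 ^ n : ℕ) : ℝ)) Filter.atTop (nhds 0) :=
    (tendsto_one_div_atTop_nhds_zero_nat (𝕜 := ℝ)).comp
      (tendsto_pow_atTop_atTop_of_one_lt one_lt_two)
  have h2 := (tendsto_const_nhds (x := C)).rpow h1 (Or.inl hC.ne')
  simpa using h2.mul_const a

theorem mul_pow_rpow_one_div {C a : ℝ} (hC : 0 < C) (ha : 0 ≤ a) (n : ℕ) :
    (C * a ^ (2 ^ n)) ^ (1 / ((2 ^ n : ℕ) : ℝ)) = C ^ (1 / ((2 ^ n : ℕ) : ℝ)) * a := by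
  rw [Real.mul_rpow hC.le (by positivity), one_div, Real.pow_rpow_inv_natCast ha (by positivity)]

theorem le_of_forall_two_pow_le {C a b : ℝ} (hC : 0 < C) (ha : 0 ≤ a) (hb : 0 ≤ b)
    (h : ∀ n : ℕ, a ^ (2 ^ n) ≤ C * b ^ (2 ^ n)) : a ≤ b := by
  refine ge_of_tendsto' (tendsto_rpow_one_div_two_pow hC b) fun n => ?_
  rw [← mul_pow_rpow_one_div hC hb]
  have h1 := Real.rpow_le_rpow (by positivity) (h n)
    (z := 1 / ((2 ^ n : ℕ) : ℝ)) (by positivity)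
  rwa [one_div, Real.pow_rpow_inv_natCast ha (by positivity), ← one_div] at h1

end Limits

section SpectralRadius

variable {B : Type*} [NormedRing B] [NormedAlgebra ℂ B]

theorem toReal_spectralRadius_le {x : B} {t : ℝ} (ht : 0 ≤ t)
    (h : ∀ z ∈ spectrum ℂ x, ‖z‖ ≤ t) : (spectralRadius ℂ x).toReal ≤ t := by
  refine ENNReal.toReal_le_of_le_ofReal ht (iSup₂_le fun z hz => ?_)
  exact (ofReal_norm z).symm.trans_le (ENNReal.ofReal_le_ofReal (h z hz))

variable [CompleteSpace B]

theorem spectralRadius_ne_top (x : B) : spectralRadius ℂ x ≠ ⊤ := by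
  have h := spectrum.spectralRadius_le_pow_nnnorm_pow_one_div ℂ x 0
  exact ne_top_of_le_ne_top (by simp [ENNReal.mul_eq_top]) h

theorem norm_le_toReal_spectralRadius {x : B} {z : ℂ} (hz : z ∈ spectrum ℂ x) :
    ‖z‖ ≤ (spectralRadius ℂ x).toReal := by
  have h : (‖z‖₊ : ENNReal) ≤ spectralRadius ℂ x :=
    le_iSup₂ (f := fun (k : ℂ) (_ : k ∈ spectrum ℂ x) => (‖k‖₊ : ENNReal)) z hz
  simpa using ENNReal.toReal_mono (spectralRadius_ne_top x) h

theorem toReal_spectralRadius_mul_comm (x y : B) :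
    (spectralRadius ℂ (x * y)).toReal = (spectralRadius ℂ (y * x)).toReal := by
  suffices H : ∀ a b : B,
      (spectralRadius ℂ (a * b)).toReal ≤ (spectralRadius ℂ (b * a)).toReal from
    (H x y).antisymm (H y x)
  intro a b
  refine toReal_spectralRadius_le ENNReal.toReal_nonneg fun z hz => ?_
  by_cases hz0 : z = 0
  · simp [hz0]
  · have h : z ∈ spectrum ℂ (a * b) \ {0} := ⟨hz, hz0⟩
    rw [spectrum.nonzero_mul_comm] at h
    exact norm_le_toReal_spectralRadius h.1

end SpectralRadius

section Banach

variable {B : Type*} [NormedRing B] [NormedAlgebra ℂ B]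

/-- The iteration `y ↦ (h + y ^ 2) / 2`, whose limit `y` satisfies `(1 - y) ^ 2 = 1 - h`. -/
noncomputable def sqrtIter (h : B) : ℕ → B
  | 0 => 0
  | n + 1 => (2⁻¹ : ℂ) • (h + sqrtIter h n * sqrtIter h n)

theorem commute_sqrtIter {h z : B} (hz : Commute z h) (n : ℕ) : Commute z (sqrtIter h n) := by
  induction n with
  | zero => exact Commute.zero_right z
  | succ n ih => exact (hz.add_right (ih.mul_right ih)).smul_right _

variable {p : Seminorm ℂ B} {C : ℝ}

theorem map_mul_le_of_norm_eq (hC : 0 < C) (hp : ∀ x : B, ‖x‖ = C * p x) (x y : B) :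
    p (x * y) ≤ C * (p x * p y) := by
  have h := norm_mul_le x y
  rw [hp, hp, hp] at h
  exact le_of_mul_le_mul_left (by linarith) hC

variable [StarRing B]

theorem map_pow_two_pow_of_isSelfAdjoint (hC : ∀ a : B, p (star a * a) = p a ^ 2) {h : B}
    (hh : star h = h) (n : ℕ) : p (h ^ (2 ^ n)) = p h ^ (2 ^ n) := by
  induction n with
  | zero => simp
  | succ n ih =>
    rw [pow_succ 2 n, pow_mul, pow_mul, ← ih, ← hC, star_pow, hh, sq]

theorem map_pow_two_pow_of_commute (hC : ∀ a : B, p (star a * a) = p a ^ 2) {x : B}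
    (hx : Commute (star x) x) (n : ℕ) : p (x ^ (2 ^ n)) = p x ^ (2 ^ n) := by
  have h : p (x ^ (2 ^ n)) ^ 2 = (p x ^ (2 ^ n)) ^ 2 := by
    rw [← hC, star_pow, ← hx.mul_pow, map_pow_two_pow_of_isSelfAdjoint hC (by simp), hC]
    ring
  exact (pow_left_inj₀ (apply_nonneg p _) (pow_nonneg (apply_nonneg p _) _) two_ne_zero).1 h

theorem map_mul_le_of_commute (hC0 : 0 < C) (hp : ∀ x : B, ‖x‖ = C * p x)
    (hC : ∀ a : B, p (star a * a) = p a ^ 2) {h k : B} (hh : star h = h) (hk : star k = k)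
    (hhk : Commute h k) : p (h * k) ≤ p h * p k := by
  refine le_of_forall_two_pow_le hC0 (apply_nonneg p _)
    (mul_nonneg (apply_nonneg p _) (apply_nonneg p _)) fun n => ?_
  rw [← map_pow_two_pow_of_isSelfAdjoint hC (by rw [star_mul, hh, hk, hhk.eq]), hhk.mul_pow,
    mul_pow, ← map_pow_two_pow_of_isSelfAdjoint hC hh, ← map_pow_two_pow_of_isSelfAdjoint hC hk]
  exact map_mul_le_of_norm_eq hC0 hp _ _

theorem star_sqrtIter {h : B} (hh : star h = h) (n : ℕ) :
    star (sqrtIter h n) = sqrtIter h n := by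
  induction n with
  | zero => exact star_zero B
  | succ n ih =>
    have := star_inv_natCast_smul (R := ℂ) 2 (h + sqrtIter h n * sqrtIter h n)
    simp only [Nat.cast_ofNat] at this
    rw [sqrtIter, this, star_add, star_mul, ih, hh]

theorem map_sqrtIter_le (hC : ∀ a : B, p (star a * a) = p a ^ 2) {h : B}
    (hh : star h = h) (hh1 : p h < 1) (n : ℕ) : p (sqrtIter h n) ≤ p h := by
  induction n with
  | zero => simp [sqrtIter]
  | succ n ih =>
    have h1 := map_add_le_add p h (sqrtIter h n * sqrtIter h n)
    have h2 := hC (sqrtIter h n)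
    rw [star_sqrtIter hh] at h2
    rw [sqrtIter, map_smul_eq_mul, norm_inv, Complex.norm_ofNat]
    nlinarith [apply_nonneg p (sqrtIter h n), apply_nonneg p h]

theorem map_sqrtIter_succ_sub_le (hC0 : 0 < C) (hp : ∀ x : B, ‖x‖ = C * p x)
    (hC : ∀ a : B, p (star a * a) = p a ^ 2) {h : B} (hh : star h = h) (hh1 : p h < 1) (n : ℕ) :
    p (sqrtIter h (n + 1) - sqrtIter h n) ≤ p h ^ n := by
  induction n with
  | zero =>
    rw [sqrtIter.eq_1, sub_zero, pow_zero]
    exact (map_sqrtIter_le hC hh hh1 1).trans hh1.le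
  | succ n ih =>
    set a := sqrtIter h (n + 1) with ha
    set b := sqrtIter h n with hb
    have hab : Commute a b := commute_sqrtIter (commute_sqrtIter (Commute.refl h) _).symm _
    have e : sqrtIter h (n + 1 + 1) - a = (2⁻¹ : ℂ) • ((a - b) * (a + b)) := by
      rw [sqrtIter, ← ha]
      nth_rw 3 [ha]
      rw [sqrtIter, ← hb, ← smul_sub, ← hab.mul_self_sub_mul_self_eq']
      congr 1
      abel
    have hsa : star a = a := star_sqrtIter hh _
    have hsb : star b = b := star_sqrtIter hh _
    rw [e, map_smul_eq_mul, norm_inv, Complex.norm_ofNat]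
    have h1 := map_mul_le_of_commute hC0 hp hC (h := a - b) (k := a + b) (by simp [hsa, hsb])
      (by simp [hsa, hsb])
      (((Commute.refl a).add_right hab).sub_left (hab.symm.add_right (Commute.refl b)))
    have h2 : p (a + b) ≤ 2 * p h := by
      linarith [map_add_le_add p a b, map_sqrtIter_le hC hh hh1 n,
        map_sqrtIter_le hC hh hh1 (n + 1)]
    have h3 := mul_le_mul ih h2 (apply_nonneg p _) (pow_nonneg (apply_nonneg p h) n)
    rw [pow_succ]
    linarith

variable [CompleteSpace B]

theorem toReal_spectralRadius_eq (hC0 : 0 < C) (hp : ∀ x : B, ‖x‖ = C * p x)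
    (hC : ∀ a : B, p (star a * a) = p a ^ 2) {x : B} (hx : Commute (star x) x) :
    (spectralRadius ℂ x).toReal = p x := by
  have h1 := ((ENNReal.tendsto_toReal (spectralRadius_ne_top x)).comp
    (spectrum.pow_norm_pow_one_div_tendsto_nhds_spectralRadius x)).comp
      (tendsto_pow_atTop_atTop_of_one_lt one_lt_two)
  refine tendsto_nhds_unique h1 ?_
  convert tendsto_rpow_one_div_two_pow hC0 (p x) using 2 with n
  simp only [Function.comp_apply]
  rw [ENNReal.toReal_ofReal (by positivity), hp, map_pow_two_pow_of_commute hC hx,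
    mul_pow_rpow_one_div hC0 (apply_nonneg p x)]

theorem map_star_eq (hC0 : 0 < C) (hp : ∀ x : B, ‖x‖ = C * p x)
    (hC : ∀ a : B, p (star a * a) = p a ^ 2) (x : B) : p (star x) = p x := by
  have h : p (star x) ^ 2 = p x ^ 2 := by
    rw [← hC, ← hC, ← toReal_spectralRadius_eq hC0 hp hC (x := star (star x) * star x) (by simp),
      ← toReal_spectralRadius_eq hC0 hp hC (x := star x * x) (by simp), star_star,
      toReal_spectralRadius_mul_comm]
  exact (pow_left_inj₀ (apply_nonneg p _) (apply_nonneg p _) two_ne_zero).1 h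

theorem isUnit_one_sub_of_isSelfAdjoint (hC0 : 0 < C) (hp : ∀ x : B, ‖x‖ = C * p x)
    (hC : ∀ a : B, p (star a * a) = p a ^ 2) {h : B} (hh : star h = h) (hh1 : p h < 1) :
    IsUnit (1 - h) := by
  by_contra hu
  have hmem : (1 : ℂ) ∈ spectrum ℂ h := by simpa [spectrum.mem_iff] using hu
  have := norm_le_toReal_spectralRadius hmem
  rw [toReal_spectralRadius_eq hC0 hp hC (by rw [hh]), norm_one] at this
  linarith

theorem isUnit_one_add_of_skew (hC0 : 0 < C) (hp : ∀ x : B, ‖x‖ = C * p x)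
    (hC : ∀ a : B, p (star a * a) = p a ^ 2) (hone : p 1 ≤ 1) {u : B} (hu : star u = -u) :
    IsUnit (1 + u) := by
  by_contra hnu
  obtain ⟨t, ht⟩ := exists_nat_gt (p u ^ 2)
  have hmem : (-(1 + t) : ℂ) ∈ spectrum ℂ (u - t) := by
    rw [spectrum.mem_iff]
    have : algebraMap ℂ B (-(1 + t)) - (u - t) = -(1 + u) := by
      simp only [map_neg, map_add, map_one, map_natCast]; abel
    rwa [this, IsUnit.neg_iff]
  have hs : star (u - t) = -(u + t) := by simp [hu]; abel
  have hct : Commute (t : B) u := Nat.cast_commute t u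
  have h1 := norm_le_toReal_spectralRadius hmem
  rw [toReal_spectralRadius_eq hC0 hp hC (by
    rw [hs]
    exact (((Commute.refl u).sub_right hct.symm).add_left
      (hct.sub_right (Commute.refl _))).neg_left)] at h1
  have h2 : p (u - t) ^ 2 ≤ (t : ℝ) ^ 2 + p u ^ 2 := by
    have e : star (u - t) * (u - t) = (t * t) • (1 : B) - u * u := by
      rw [hs, nsmul_one, Nat.cast_mul, neg_mul, add_mul, mul_sub, mul_sub, hct.eq]; abel
    have h3 : p ((t * t) • (1 : B)) = (t * t) * p 1 := by
      rw [← Nat.cast_smul_eq_nsmul ℂ, map_smul_eq_mul]; simp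
    have h4 : p (u * u) = p u ^ 2 := by simpa [hu] using hC u
    rw [← hC, e, ← h4]
    refine (map_sub_le_add p _ _).trans ?_
    rw [h3]
    nlinarith [mul_self_nonneg (t : ℝ)]
  have h3 : ‖(-(1 + t) : ℂ)‖ = 1 + t := by
    rw [norm_neg]
    exact_mod_cast Complex.norm_natCast (1 + t)
  rw [h3] at h1
  nlinarith [(Nat.cast_nonneg t : (0 : ℝ) ≤ t)]

theorem exists_sqrt_one_sub (hC0 : 0 < C) (hp : ∀ x : B, ‖x‖ = C * p x)
    (hC : ∀ a : B, p (star a * a) = p a ^ 2) {h : B} (hh : star h = h) (hh1 : p h < 1) :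
    ∃ w : Bˣ, star w = w ∧ (w * w : B) = 1 - h := by
  have hstar : ∀ x : B, ‖star x‖ = ‖x‖ := fun x => by
    rw [hp, hp, map_star_eq hC0 hp hC]
  have : NormedStarGroup B := ⟨fun x => (hstar x).le⟩
  have hcau : CauchySeq (sqrtIter h) := by
    refine cauchySeq_of_le_geometric (p h) C hh1 fun n => ?_
    rw [dist_comm, dist_eq_norm, hp]
    exact mul_le_mul_of_nonneg_left (map_sqrtIter_succ_sub_le hC0 hp hC hh hh1 n) hC0.le
  obtain ⟨y, hy⟩ := cauchySeq_tendsto_of_complete hcau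
  have hys : star y = y := by
    refine tendsto_nhds_unique ?_ hy
    simpa only [star_sqrtIter hh] using hy.star
  have hyp : p y ≤ p h := by
    have := le_of_tendsto' hy.norm fun n =>
      (hp _).trans_le (mul_le_mul_of_nonneg_left (map_sqrtIter_le hC hh hh1 n) hC0.le)
    rw [hp] at this
    exact le_of_mul_le_mul_left this hC0
  have hyeq : y = (2⁻¹ : ℂ) • (h + y * y) :=
    tendsto_nhds_unique ((Filter.tendsto_add_atTop_iff_nat 1).2 hy)
      (((hy.mul hy).const_add h).const_smul (2⁻¹ : ℂ))
  have hyy : y + y = h + y * y := by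
    nth_rw 1 2 [hyeq]
    rw [← add_smul]
    norm_num
  obtain ⟨w, hw⟩ := isUnit_one_sub_of_isSelfAdjoint hC0 hp hC hys (hyp.trans_lt hh1)
  refine ⟨w, Units.ext ?_, ?_⟩
  · rw [Units.coe_star, hw, star_sub, star_one, hys]
  · rw [hw, show (1 - y) * (1 - y) = 1 - (y + y) + y * y by noncomm_ring, hyy]
    abel

theorem isUnit_one_sub_add (hC0 : 0 < C) (hp : ∀ x : B, ‖x‖ = C * p x)
    (hC : ∀ a : B, p (star a * a) = p a ^ 2) (hone : p 1 ≤ 1) {h u : B} (hh : star h = h)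
    (hh1 : p h < 1) (hu : star u = -u) : IsUnit (1 - h + u) := by
  obtain ⟨w, hws, hw⟩ := exists_sqrt_one_sub hC0 hp hC hh hh1
  have hinv : star (↑w⁻¹ : B) = ↑w⁻¹ := by
    rw [← Units.coe_star_inv, hws]
  have hskew : star (↑w⁻¹ * u * ↑w⁻¹ : B) = -(↑w⁻¹ * u * ↑w⁻¹) := by
    simp [hinv, hu, mul_assoc]
  have e : 1 - h + u = w * (1 + ↑w⁻¹ * u * ↑w⁻¹) * w := by
    rw [← hw]
    simp [mul_add, add_mul, mul_assoc]
  rw [e]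
  exact (w.isUnit.mul (isUnit_one_add_of_skew hC0 hp hC hone hskew)).mul w.isUnit

theorem isUnit_one_sub (hC0 : 0 < C) (hp : ∀ x : B, ‖x‖ = C * p x)
    (hC : ∀ a : B, p (star a * a) = p a ^ 2) (hone : p 1 ≤ 1) {x : B} (hx : p x < 1) :
    IsUnit (1 - x) := by
  have hskew : star (star x - x) = -(star x - x) := by simp
  have hlt : p x ^ 2 < 1 := by nlinarith [apply_nonneg p x]
  have hl : IsUnit ((1 + star x) * (1 - x)) := by
    rw [show (1 + star x) * (1 - x) = 1 - star x * x + (star x - x) by noncomm_ring]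
    exact isUnit_one_sub_add hC0 hp hC hone (by simp) (by rwa [hC]) hskew
  have hr : IsUnit ((1 - x) * (1 + star x)) := by
    rw [show (1 - x) * (1 + star x) = 1 - x * star x + (star x - x) by noncomm_ring]
    refine isUnit_one_sub_add hC0 hp hC hone (by simp) ?_ hskew
    have := hC (star x)
    rw [star_star, map_star_eq hC0 hp hC] at this
    rwa [this]
  obtain ⟨a, ha⟩ := hl.exists_left_inv
  obtain ⟨b, hb⟩ := hr.exists_right_inv
  exact isUnit_iff_exists_and_exists.2
    ⟨⟨_, by rw [← mul_assoc]; exact hb⟩, ⟨_, by rw [mul_assoc]; exact ha⟩⟩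

theorem toReal_spectralRadius_le_map (hC0 : 0 < C) (hp : ∀ x : B, ‖x‖ = C * p x)
    (hC : ∀ a : B, p (star a * a) = p a ^ 2) (hone : p 1 ≤ 1) (x : B) :
    (spectralRadius ℂ x).toReal ≤ p x := by
  refine toReal_spectralRadius_le (apply_nonneg p x) fun z hz => ?_
  by_contra! hlt
  have hz0 : z ≠ 0 := norm_pos_iff.1 ((apply_nonneg p x).trans_lt hlt)
  have hlt1 : p (z⁻¹ • x) < 1 := by
    rw [map_smul_eq_mul, norm_inv, inv_mul_lt_iff₀ (norm_pos_iff.2 hz0), mul_one]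
    exact hlt
  refine hz ?_
  have h := (Units.mk0 z hz0).isUnit.map (algebraMap ℂ B) |>.mul
    (isUnit_one_sub hC0 hp hC hone hlt1)
  rw [spectrum.mem_resolventSet_iff]
  simpa [mul_sub, Algebra.algebraMap_eq_smul_one, smul_smul, hz0] using h

theorem map_mul_le_of_isSelfAdjoint (hC0 : 0 < C) (hp : ∀ x : B, ‖x‖ = C * p x)
    (hC : ∀ a : B, p (star a * a) = p a ^ 2) (hone : p 1 ≤ 1) {h k : B} (hh : star h = h)
    (hk : star k = k) : p (h * k) ≤ p h * p k := by
  have key : ∀ a b : B, star a = a → star b = b → p (a * b) ^ 2 ≤ p (a ^ 2 * b ^ 2) := by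
    intro a b ha hb
    rw [← hC, ← toReal_spectralRadius_eq hC0 hp hC (x := star (a * b) * (a * b)) (by simp),
      star_mul, ha, hb, show b * a * (a * b) = b * (a * a * b) by noncomm_ring,
      toReal_spectralRadius_mul_comm, show a * a * b * b = a ^ 2 * b ^ 2 by noncomm_ring]
    exact toReal_spectralRadius_le_map hC0 hp hC hone _
  have key2 : ∀ n : ℕ, p (h * k) ^ (2 ^ n) ≤ p (h ^ (2 ^ n) * k ^ (2 ^ n)) := by
    intro n
    induction n with
    | zero => simp
    | succ n ih =>
      rw [pow_succ 2 n, pow_mul, pow_mul, pow_mul]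
      exact (pow_le_pow_left₀ (pow_nonneg (apply_nonneg p _) _) ih 2).trans
        (key _ _ (by rw [star_pow, hh]) (by rw [star_pow, hk]))
  refine le_of_forall_two_pow_le hC0 (apply_nonneg p _)
    (mul_nonneg (apply_nonneg p _) (apply_nonneg p _)) fun n => (key2 n).trans ?_
  rw [mul_pow, ← map_pow_two_pow_of_isSelfAdjoint hC hh, ← map_pow_two_pow_of_isSelfAdjoint hC hk]
  exact map_mul_le_of_norm_eq hC0 hp _ _

theorem map_mul_le_of_complete (hC0 : 0 < C) (hp : ∀ x : B, ‖x‖ = C * p x)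
    (hC : ∀ a : B, p (star a * a) = p a ^ 2) (hone : p 1 ≤ 1) (x y : B) :
    p (x * y) ≤ p x * p y := by
  refine (sq_le_sq₀ (apply_nonneg p _) (mul_nonneg (apply_nonneg p x) (apply_nonneg p y))).1 ?_
  have hy := hC (star y)
  rw [star_star, map_star_eq hC0 hp hC] at hy
  rw [mul_pow, ← hC, ← hC x, ← hy,
    ← toReal_spectralRadius_eq hC0 hp hC (x := star (x * y) * (x * y)) (by simp), star_mul,
    show star y * star x * (x * y) = star y * (star x * x * y) by noncomm_ring,
    toReal_spectralRadius_mul_comm, mul_assoc]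
  exact (toReal_spectralRadius_le_map hC0 hp hC hone _).trans
    (map_mul_le_of_isSelfAdjoint hC0 hp hC hone (by simp) (by simp))

end Banach

section Completion

open UniformSpace

variable {A : Type*} [SeminormedRing A] [StarRing A]

/-- A uniformly continuous involution extends to the completion. -/
noncomputable abbrev completionStarRing (hs : UniformContinuous (star : A → A)) :
    StarRing (Completion A) where
  star := Completion.map star
  star_involutive x := by
    have hc : Continuous (Completion.map (star : A → A)) := Completion.continuous_map
    induction x using Completion.induction_on with
    | hp => exact isClosed_eq (hc.comp hc) continuous_id
    | ih a => rw [Completion.map_coe hs, Completion.map_coe hs, star_star]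
  star_mul x y := by
    have hc : Continuous (Completion.map (star : A → A)) := Completion.continuous_map
    induction x, y using Completion.induction_on₂ with
    | hp => exact isClosed_eq (by fun_prop) (by fun_prop)
    | ih a b =>
      change Completion.map star _ = Completion.map star _ * Completion.map star _
      rw [← Completion.coe_mul, Completion.map_coe hs, Completion.map_coe hs,
        Completion.map_coe hs, ← Completion.coe_mul, star_mul]
  star_add x y := by
    have hc : Continuous (Completion.map (star : A → A)) := Completion.continuous_map
    induction x, y using Completion.induction_on₂ with
    | hp => exact isClosed_eq (by fun_prop) (by fun_prop)
    | ih a b =>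
      change Completion.map star _ = Completion.map star _ + Completion.map star _
      rw [← Completion.coe_add, Completion.map_coe hs, Completion.map_coe hs,
        Completion.map_coe hs, ← Completion.coe_add, star_add]

theorem norm_mul_le_of_norm_sq_eq [NormedAlgebra ℂ A] (hs : UniformContinuous (star : A → A))
    {C : ℝ} (hC : 0 < C) (h : ∀ x : A, C * ‖star x * x‖ = ‖x‖ ^ 2) (hone : ‖(1 : A)‖ ≤ C)
    (x y : A) : C * ‖x * y‖ ≤ ‖x‖ * ‖y‖ := by
  let _ : NormedAlgebra ℂ (Completion A) := { norm_smul_le := norm_smul_le }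
  let _ : StarRing (Completion A) := completionStarRing hs
  have hc : Continuous (star : Completion A → Completion A) := Completion.continuous_map
  have hCC (x : Completion A) : C * ‖star x * x‖ = ‖x‖ ^ 2 := by
    induction x using Completion.induction_on with
    | hp => exact isClosed_eq (by fun_prop) (by fun_prop)
    | ih a =>
      have e : star (a : Completion A) = (star a : A) := Completion.map_coe hs a
      rw [e, ← Completion.coe_mul, Completion.norm_coe, Completion.norm_coe, h]
  let p : Seminorm ℂ (Completion A) := NNReal.mk C⁻¹ (by positivity) •
    normSeminorm ℂ (Completion A)
  have hp (x : Completion A) : p x = C⁻¹ * ‖x‖ := rfl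
  have key := map_mul_le_of_complete (p := p) hC (fun x => by rw [hp]; field_simp)
    (fun x => by rw [hp, hp, mul_pow, ← hCC]; field_simp)
    (by rw [hp, ← Completion.coe_one, Completion.norm_coe, inv_mul_le_iff₀ hC]; simpa using hone)
    x y
  rw [← Completion.coe_mul, hp, hp, hp, Completion.norm_coe, Completion.norm_coe,
    Completion.norm_coe, mul_mul_mul_comm, inv_mul_le_iff₀ hC] at key
  field_simp at key
  linarith

end Completion
end CStarSeminorm

/-- Every seminorm `p` on a `*`-algebra `A` satisfying the C*-condition
`p (a* a) = p a ^ 2` is submultiplicative. -/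
theorem cstar_seminorm_submultiplicative {A : Type*} [Ring A] [StarRing A] [Algebra ℂ A]
    (p : Seminorm ℂ A) (hC : ∀ a : A, p (star a * a) = p a ^ 2) :
    ∀ a b : A, p (a * b) ≤ p a * p b := by
  obtain ⟨C, hC0, H⟩ := CStarSeminorm.exists_map_mul_le hC
  intro a b
  let P : Seminorm ℂ A := NNReal.mk C hC0.le • p
  let _ : SeminormedRing A :=
    { ‹Ring A›, P.toAddGroupSeminorm.toSeminormedAddCommGroup with
      norm_mul_le := fun x y => by
        change C * p (x * y) ≤ C * p x * (C * p y)
        calc C * p (x * y) ≤ C * (C * (p x * p y)) := mul_le_mul_of_nonneg_left (H x y) hC0.le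
          _ = _ := by ring }
  have hnorm (x : A) : ‖x‖ = C * p x := rfl
  let _ : NormedAlgebra ℂ A := { norm_smul_le := fun r x => (map_smul_eq_mul P r x).le }
  have hs : UniformContinuous (star : A → A) :=
    AddMonoidHomClass.uniformContinuous_of_bound (starAddEquiv : A ≃+ A) 10 fun x => by
      have := mul_le_mul_of_nonneg_left (CStarSeminorm.map_star_le hC x) hC0.le
      change C * p (star x) ≤ 10 * (C * p x)
      linarith
  have h := CStarSeminorm.norm_mul_le_of_norm_sq_eq hs hC0
    (fun x => by rw [hnorm, hnorm, hC]; ring)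
    (by rw [hnorm]; exact mul_le_of_le_one_right hC0.le (CStarSeminorm.map_one_le hC)) a b
  rw [hnorm, hnorm, hnorm] at h
  refine le_of_mul_le_mul_left ?_ (mul_pos hC0 hC0)
  linarith
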